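/- arXiv:1604.03000 — 4 statements merged into one kernel-verified Lean document; each statement's English description precedes it below -/
import Mathlib

section
/- Let n ≥ 1 and q ≥ 2 be integers and t ≥ k ≥ ℓ ≥ 0 integers with k ≥ 1 and n ≥ ℓ+1. Let X' = aX ∈ 𝔽_q^{n+t−k} and Y' = aY ∈ 𝔽_q^n be sequences beginning with the same symbol a ∈ 𝔽_q, with X' ≠ Y' and d_e(X',Y') = t−k+2ℓ. Then |I_k(X') ∩ I_t(Y')| ≤ N⁺_q(n−1,t,k,ℓ) + (q−1)·N⁺_q(n,t−1,k−1,ℓ). -/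
open scoped BigOperators

/-- The insertion ball `I_t(X)`: supersequences of `X` of length `X.length + t`. -/
def insBall (q t : ℕ) (X : List (Fin q)) : Set (List (Fin q)) :=
  {W | W.length = X.length + t ∧ X.Sublist W}

/-- Length of a longest common subsequence of `X` and `Y`. -/
noncomputable def lcsLen {q : ℕ} (X Y : List (Fin q)) : ℕ :=
  sSup {m | ∃ Z : List (Fin q), Z.Sublist X ∧ Z.Sublist Y ∧ Z.length = m}

/-- The edit distance `d_e(X,Y) = |X| + |Y| - 2L`. -/
noncomputable def editDist {q : ℕ} (X Y : List (Fin q)) : ℕ :=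
  X.length + Y.length - 2 * lcsLen X Y

/-- `N⁺_q(n,t,k,ℓ)`: the maximum of `|I_k(X) ∩ I_t(Y)|` over pairs `X ∈ 𝔽_q^{n+t-k}`,
`Y ∈ 𝔽_q^n` with `d_e(X,Y) ≥ t-k+2ℓ`. -/
noncomputable def Nplus (q n t k ℓ : ℕ) : ℕ :=
  sSup {c | ∃ X Y : List (Fin q), X.length = n + t - k ∧ Y.length = n ∧
    t - k + 2 * ℓ ≤ editDist X Y ∧ c = (insBall q k X ∩ insBall q t Y).ncard}

theorem finite_insBall (q t : ℕ) (X : List (Fin q)) : (insBall q t X).Finite :=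
  (List.finite_length_eq (Fin q) (X.length + t)).subset fun _ h => h.1

theorem bddAbove_length_common_sublist {q : ℕ} (X Y : List (Fin q)) :
    BddAbove {m | ∃ Z : List (Fin q), Z.Sublist X ∧ Z.Sublist Y ∧ Z.length = m} := by
  refine ⟨X.length, ?_⟩
  rintro m ⟨Z, hZX, -, rfl⟩
  exact hZX.length_le

theorem lcsLen_add_one_le_lcsLen_cons {q : ℕ} (a : Fin q) (X Y : List (Fin q)) :
    lcsLen X Y + 1 ≤ lcsLen (a :: X) (a :: Y) := by
  obtain ⟨Z, hZX, hZY, hZ⟩ : lcsLen X Y ∈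
      {m | ∃ Z : List (Fin q), Z.Sublist X ∧ Z.Sublist Y ∧ Z.length = m} :=
    Nat.sSup_mem ⟨0, [], List.nil_sublist _, List.nil_sublist _, rfl⟩
      (bddAbove_length_common_sublist X Y)
  refine le_csSup (bddAbove_length_common_sublist _ _)
    ⟨a :: Z, hZX.cons_cons a, hZY.cons_cons a, ?_⟩
  simp [hZ]

theorem editDist_cons_le {q : ℕ} (a : Fin q) (X Y : List (Fin q)) :
    editDist (a :: X) (a :: Y) ≤ editDist X Y := by
  have h := lcsLen_add_one_le_lcsLen_cons a X Y
  simp only [editDist, List.length_cons]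
  omega

theorem ncard_insBall_inter_le_Nplus {q n t k ℓ : ℕ} {X Y : List (Fin q)}
    (hX : X.length = n + t - k) (hY : Y.length = n) (hd : t - k + 2 * ℓ ≤ editDist X Y) :
    (insBall q k X ∩ insBall q t Y).ncard ≤ Nplus q n t k ℓ := by
  refine le_csSup ⟨{W : List (Fin q) | W.length = n + t}.ncard, ?_⟩ ⟨X, Y, hX, hY, hd, rfl⟩
  rintro c ⟨X', Y', -, hY', -, rfl⟩
  refine Set.ncard_le_ncard (fun W hW => ?_) (List.finite_length_eq (Fin q) (n + t))
  exact hW.2.1.trans (by rw [hY'])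

/-- A common supersequence of `a :: X` and `a :: Y` starts with `a` and continues with a common
supersequence of `X` and `Y`, or starts with another symbol and continues with a common
supersequence of `a :: X` and `a :: Y`. -/
theorem insBall_cons_inter_subset {q k t : ℕ} (hk : 1 ≤ k) (ht : 1 ≤ t) (a : Fin q)
    (X Y : List (Fin q)) :
    insBall q k (a :: X) ∩ insBall q t (a :: Y) ⊆
      List.cons a '' (insBall q k X ∩ insBall q t Y) ∪
        (fun p : Fin q × List (Fin q) => p.1 :: p.2) ''
          ({a}ᶜ ×ˢ (insBall q (k - 1) (a :: X) ∩ insBall q (t - 1) (a :: Y))) := by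
  rintro W ⟨⟨hWX, hsX⟩, hWY, hsY⟩
  cases W with
  | nil => simp at hsX
  | cons b W =>
    simp only [List.length_cons] at hWX hWY
    by_cases hb : b = a
    · subst hb
      exact .inl ⟨W, ⟨⟨by omega, hsX.of_cons_cons⟩, by omega, hsY.of_cons_cons⟩, rfl⟩
    · refine .inr ⟨(b, W), ⟨hb, ⟨by simp only [List.length_cons]; omega, ?_⟩,
        by simp only [List.length_cons]; omega, ?_⟩, rfl⟩
      · exact List.Sublist.of_cons_of_ne (Ne.symm hb) hsX
      · exact List.Sublist.of_cons_of_ne (Ne.symm hb) hsY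

theorem intersection_bound_same_first_symbol (q n t k ℓ : ℕ) (hq : 2 ≤ q) (hn : 1 ≤ n)
    (hkt : k ≤ t) (hlk : ℓ ≤ k) (hk : 1 ≤ k) (hln : ℓ + 1 ≤ n)
    (a : Fin q) (X Y : List (Fin q))
    (hX : (a :: X).length = n + t - k) (hY : (a :: Y).length = n)
    (hne : a :: X ≠ a :: Y) (hd : editDist (a :: X) (a :: Y) = t - k + 2 * ℓ) :
    (insBall q k (a :: X) ∩ insBall q t (a :: Y)).ncard ≤
      Nplus q (n - 1) t k ℓ + (q - 1) * Nplus q n (t - 1) (k - 1) ℓ := by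
  simp only [List.length_cons] at hX hY
  have ht : 1 ≤ t := hk.trans hkt
  have hA : (insBall q k X ∩ insBall q t Y).ncard ≤ Nplus q (n - 1) t k ℓ :=
    ncard_insBall_inter_le_Nplus (by omega) (by omega) (hd ▸ editDist_cons_le a X Y)
  have hB : (insBall q (k - 1) (a :: X) ∩ insBall q (t - 1) (a :: Y)).ncard ≤
      Nplus q n (t - 1) (k - 1) ℓ :=
    ncard_insBall_inter_le_Nplus (by simp only [List.length_cons]; omega)
      (by simpa using hY) (by omega)
  have hfinA := (finite_insBall q k X).inter_of_left (insBall q t Y)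
  have hfinB := (Set.toFinite ({a}ᶜ : Set (Fin q))).prod
    ((finite_insBall q (k - 1) (a :: X)).inter_of_left (insBall q (t - 1) (a :: Y)))
  refine (Set.ncard_le_ncard (insBall_cons_inter_subset hk ht a X Y)
    ((hfinA.image _).union (hfinB.image _))).trans ((Set.ncard_union_le _ _).trans ?_)
  refine add_le_add ((Set.ncard_image_le hfinA).trans hA) ((Set.ncard_image_le hfinB).trans ?_)
  have hcompl : ({a}ᶜ : Set (Fin q)).ncard = q - 1 := by
    rw [Set.ncard_compl, Set.ncard_singleton, Nat.card_fin]
  rw [Set.ncard_prod, hcompl]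
  exact Nat.mul_le_mul_left _ hB
end

section
/- Let n ≥ 1 and t ≥ k ≥ 1 be integers, let X ∈ 𝔽_q^{n+t−k−1} and Y ∈ 𝔽_q^{n−1} be sequences, and let a, b ∈ 𝔽_q with a ≠ b. Then |I_k(aX) ∩ I_t(bY)| = |I_k(X) ∩ I_{t−1}(bY)| + |I_{k−1}(aX) ∩ I_t(Y)| + (q−2)·|I_{k−1}(aX) ∩ I_{t−1}(bY)|, where aX denotes the sequence a prepended to X. -/
open scoped BigOperators

/-- A finite set of nonempty lists is counted by splitting according to the first symbol. -/
theorem ncard_eq_sum_ncard_cons_preimage {α : Type*} [Fintype α] {S : Set (List α)}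
    (hS : S.Finite) (hnil : [] ∉ S) :
    S.ncard = ∑ c : α, (List.cons c ⁻¹' S).ncard := by
  have hU : S = ⋃ c : α, List.cons c '' (List.cons c ⁻¹' S) := by
    ext W
    cases W with
    | nil => simp [hnil]
    | cons d W => simp
  have hfin (c : α) : (List.cons c '' (List.cons c ⁻¹' S)).Finite :=
    hS.subset (Set.image_preimage_subset _ _)
  conv_lhs => rw [hU]
  rw [Set.ncard_iUnion_of_finite hfin, finsum_eq_sum_of_fintype]
  · exact Finset.sum_congr rfl fun c _ => Set.ncard_image_of_injective _ List.cons_injective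
  · intro c d hcd
    rw [Function.onFun, Set.disjoint_left]
    rintro _ ⟨W, -, rfl⟩ ⟨V, -, h⟩
    exact hcd (List.cons.inj h).1.symm

theorem cons_preimage_insBall_cons_self {q t : ℕ} (a : Fin q) (X : List (Fin q)) :
    List.cons a ⁻¹' insBall q t (a :: X) = insBall q t X := by
  ext W
  simp only [insBall, Set.mem_preimage, Set.mem_ofPred_eq, List.length_cons,
    List.cons_sublist_cons]
  exact and_congr_left' (by omega)

theorem cons_preimage_insBall_cons_of_ne {q t : ℕ} (ht : 1 ≤ t) {a c : Fin q} (hca : c ≠ a)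
    (X : List (Fin q)) :
    List.cons c ⁻¹' insBall q t (a :: X) = insBall q (t - 1) (a :: X) := by
  ext W
  simp only [insBall, Set.mem_preimage, Set.mem_ofPred_eq, List.length_cons,
    List.cons_sublist_cons']
  refine and_congr (by omega) ⟨?_, Or.inl⟩
  rintro (h | ⟨h, -⟩)
  · exact h
  · exact absurd h.symm hca

theorem intersection_recursion_diff_first_symbol (q n t k : ℕ) (hn : 1 ≤ n)
    (hkt : k ≤ t) (hk : 1 ≤ k)
    (a b : Fin q) (hab : a ≠ b) (X Y : List (Fin q))
    (hX : X.length = n + t - k - 1) (hY : Y.length = n - 1) :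
    (insBall q k (a :: X) ∩ insBall q t (b :: Y)).ncard =
      (insBall q k X ∩ insBall q (t - 1) (b :: Y)).ncard +
        (insBall q (k - 1) (a :: X) ∩ insBall q t Y).ncard +
        (q - 2) * (insBall q (k - 1) (a :: X) ∩ insBall q (t - 1) (b :: Y)).ncard := by
  have ht : 1 ≤ t := hk.trans hkt
  rw [ncard_eq_sum_ncard_cons_preimage ((finite_insBall q k (a :: X)).inter_of_left _)
      (fun h => by simpa using h.1.2),
    ← Finset.sum_add_sum_compl {a, b}, Finset.sum_pair hab]
  simp only [Set.preimage_inter, cons_preimage_insBall_cons_self,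
    cons_preimage_insBall_cons_of_ne ht hab, cons_preimage_insBall_cons_of_ne hk hab.symm]
  congr 1
  have hcard : ({a, b}ᶜ : Finset (Fin q)).card = q - 2 := by
    rw [Finset.card_compl, Finset.card_pair hab, Fintype.card_fin]
  rw [← hcard, ← smul_eq_mul]
  refine Finset.sum_eq_card_nsmul fun c hc => ?_
  simp only [Finset.mem_compl, Finset.mem_insert, Finset.mem_singleton, not_or] at hc
  rw [cons_preimage_insBall_cons_of_ne hk hc.1, cons_preimage_insBall_cons_of_ne ht hc.2]
end

section
/- Let q ≥ 2 be an integer, n a positive integer, and t ≥ k ≥ 0 integers with n ≥ k. Then N⁺_q(n,t,k,k) = C(t+k, k); that is, the maximum of |I_k(X) ∩ I_t(Y)| over all pairs X ∈ 𝔽_q^{n+t−k}, Y ∈ 𝔽_q^n with d_e(X,Y) ≥ t+k equals the binomial coefficient C(t+k, k). -/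
open scoped BigOperators

/-- Two subsequences of a common word overlap in a long common subsequence. -/
theorem exists_common_sublist {α : Type*} (W : List α) : ∀ X Y : List α, X.Sublist W → Y.Sublist W →
    ∃ Z : List α, Z.Sublist X ∧ Z.Sublist Y ∧ X.length + Y.length ≤ W.length + Z.length := by
  induction W with
  | nil =>
    intro X Y hX hY
    obtain rfl := List.sublist_nil.mp hX
    obtain rfl := List.sublist_nil.mp hY
    exact ⟨[], by simp⟩
  | cons w W ih =>
    intro X Y hX hY
    rcases List.sublist_cons_iff.mp hX with hXW | ⟨X', rfl, hXW⟩ <;>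
      rcases List.sublist_cons_iff.mp hY with hYW | ⟨Y', rfl, hYW⟩ <;>
      obtain ⟨Z, hZX, hZY, hZ⟩ := ih _ _ hXW hYW
    · exact ⟨Z, hZX, hZY, by grind⟩
    · exact ⟨Z, hZX, hZY.cons _, by grind⟩
    · exact ⟨Z, hZX.cons _, hZY, by grind⟩
    · exact ⟨w :: Z, hZX.cons_cons _, hZY.cons_cons _, by grind⟩

/-- The common supersequences of `X` and `Y` of length `m`. -/
def commonSupers {α : Type*} (m : ℕ) (X Y : List α) : Set (List α) :=
  {W | W.length = m ∧ X.Sublist W ∧ Y.Sublist W}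

theorem encard_commonSupers_le_one_left {α : Type*} {m : ℕ} {X Y : List α} (h : m ≤ X.length) :
    (commonSupers m X Y).encard ≤ 1 := by
  rw [Set.encard_le_one_iff]
  rintro V W ⟨hV, hXV, -⟩ ⟨hW, hXW, -⟩
  rw [← hXV.eq_of_length_le (by omega), ← hXW.eq_of_length_le (by omega)]

theorem encard_commonSupers_le_one_right {α : Type*} {m : ℕ} {X Y : List α} (h : m ≤ Y.length) :
    (commonSupers m X Y).encard ≤ 1 := by
  rw [Set.encard_le_one_iff]
  rintro V W ⟨hV, -, hYV⟩ ⟨hW, -, hYW⟩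
  rw [← hYV.eq_of_length_le (by omega), ← hYW.eq_of_length_le (by omega)]

/-- The number of shortest common supersequences is at most a binomial coefficient. -/
theorem encard_commonSupers_le {α : Type*} (X : List α) : ∀ (Y : List α) (L t k : ℕ),
    X.length = L + t → Y.length = L + k →
    (∀ Z : List α, Z.Sublist X → Z.Sublist Y → Z.length ≤ L) →
    (commonSupers (L + t + k) X Y).encard ≤ ((t + k).choose k : ℕ) := by
  induction X with
  | nil =>
    intro Y L t k hX hY _
    refine (encard_commonSupers_le_one_right (by simp at hX; omega)).trans ?_
    exact_mod_cast Nat.choose_pos (by omega)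
  | cons x X ihX =>
    intro Y
    induction Y with
    | nil =>
      intro L t k hX hY _
      refine (encard_commonSupers_le_one_left (by simp at hY; omega)).trans ?_
      exact_mod_cast Nat.choose_pos (by omega)
    | cons y Y ihY =>
      intro L t k hX hY hL
      have not_both {W : List α} (hW : W.length + 1 = L + t + k)
          (h₁ : (x :: X).Sublist W) (h₂ : (y :: Y).Sublist W) : False := by
        obtain ⟨Z, hZX, hZY, hZ⟩ := exists_common_sublist W _ _ h₁ h₂
        have := hL Z hZX hZY
        omega
      by_cases hxy : x = y
      · subst hxy
        have hLpos : 1 ≤ L := by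
          simpa using hL [x] (by simp) (by simp)
        obtain ⟨L, rfl⟩ := Nat.exists_eq_add_of_le' hLpos
        have hsub : commonSupers (L + 1 + t + k) (x :: X) (x :: Y) ⊆
            List.cons x '' commonSupers (L + t + k) X Y := by
          rintro W ⟨hW, hXW, hYW⟩
          cases W with
          | nil => simp at hXW
          | cons w W =>
            simp only [List.length_cons] at hW hX hY
            rcases List.cons_sublist_cons'.mp hXW with h₁ | ⟨rfl, h₁⟩
            · rcases List.cons_sublist_cons'.mp hYW with h₂ | ⟨rfl, h₂⟩
              · exact (not_both (by omega) h₁ h₂).elim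
              · exact ⟨W, ⟨by omega, (List.sublist_cons_self _ _).trans h₁, h₂⟩, rfl⟩
            · exact ⟨W, ⟨by omega, h₁, List.cons_sublist_cons.mp hYW⟩, rfl⟩
        refine (Set.encard_le_encard hsub).trans ?_
        rw [(List.cons_injective).encard_image]
        refine ihX Y L t k (by simp at hX; omega) (by simp at hY; omega) fun Z h₁ h₂ => ?_
        simpa using hL (x :: Z) (h₁.cons_cons _) (h₂.cons_cons _)
      · rcases t with _ | t
        · refine (encard_commonSupers_le_one_right (by omega)).trans ?_
          exact_mod_cast Nat.choose_pos (by omega)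
        rcases k with _ | k
        · refine (encard_commonSupers_le_one_left (by omega)).trans ?_
          exact_mod_cast Nat.choose_pos (by omega)
        have hsub : commonSupers (L + (t + 1) + (k + 1)) (x :: X) (y :: Y) ⊆
            List.cons x '' commonSupers (L + t + (k + 1)) X (y :: Y) ∪
            List.cons y '' commonSupers (L + (t + 1) + k) (x :: X) Y := by
          rintro W ⟨hW, hXW, hYW⟩
          cases W with
          | nil => simp at hXW
          | cons w W =>
            simp only [List.length_cons] at hW
            rcases List.cons_sublist_cons'.mp hXW with h₁ | ⟨rfl, h₁⟩ <;>
              rcases List.cons_sublist_cons'.mp hYW with h₂ | ⟨rfl, h₂⟩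
            · exact (not_both (by omega) h₁ h₂).elim
            · exact Or.inr ⟨W, ⟨by omega, h₁, h₂⟩, rfl⟩
            · exact Or.inl ⟨W, ⟨by omega, h₁, h₂⟩, rfl⟩
            · exact (hxy rfl).elim
        refine (Set.encard_le_encard hsub).trans ((Set.encard_union_le _ _).trans ?_)
        rw [(List.cons_injective).encard_image, (List.cons_injective).encard_image]
        have h₁ := ihX (y :: Y) L t (k + 1) (by simp at hX; omega) hY
          fun Z h₁ h₂ => hL Z (h₁.cons _) h₂
        have h₂ := ihY L (t + 1) k hX (by simp at hY; omega)
          fun Z h₁ h₂ => hL Z h₁ (h₂.cons _)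
        refine (add_le_add h₁ h₂).trans ?_
        have := Nat.choose_succ_succ (t + 1 + k) k
        rw [show t + 1 + (k + 1) = (t + 1 + k) + 1 by omega,
          show t + (k + 1) = t + 1 + k by omega]
        norm_cast
        simp only [Nat.succ_eq_add_one] at this
        omega

/-- Words with `t` copies of `a` and `k` copies of `b` number at least `C(t+k, k)`. -/
theorem choose_le_encard_commonSupers_replicate {α : Type*} {a b : α} (hab : a ≠ b) (t k : ℕ) :
    ((t + k).choose k : ℕ) ≤
      (commonSupers (t + k) (List.replicate t a) (List.replicate k b)).encard := by
  induction t generalizing k with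
  | zero =>
    simp only [zero_add, Nat.choose_self, Nat.cast_one, Set.one_le_encard_iff_nonempty]
    exact ⟨List.replicate k b, by simp [commonSupers]⟩
  | succ t iht =>
    induction k with
    | zero =>
      simp only [add_zero, Nat.choose_zero_right, Nat.cast_one, Set.one_le_encard_iff_nonempty]
      exact ⟨List.replicate (t + 1) a, by simp [commonSupers]⟩
    | succ k ihk =>
      have hsub : List.cons a '' commonSupers (t + (k + 1)) (List.replicate t a)
            (List.replicate (k + 1) b) ∪
          List.cons b '' commonSupers (t + 1 + k) (List.replicate (t + 1) a)
            (List.replicate k b) ⊆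
          commonSupers (t + 1 + (k + 1)) (List.replicate (t + 1) a)
            (List.replicate (k + 1) b) := by
        rintro _ (⟨W, ⟨hW, h₁, h₂⟩, rfl⟩ | ⟨W, ⟨hW, h₁, h₂⟩, rfl⟩)
        · exact ⟨by simp [hW]; omega, by simpa [List.replicate_succ] using h₁, h₂.cons _⟩
        · exact ⟨by simp [hW]; omega, h₁.cons _, by simpa [List.replicate_succ] using h₂⟩
      refine le_trans ?_ (Set.encard_le_encard hsub)
      rw [Set.encard_union_eq, (List.cons_injective).encard_image,
        (List.cons_injective).encard_image]
      · refine le_trans ?_ (add_le_add (iht (k + 1)) ihk)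
        have := Nat.choose_succ_succ (t + 1 + k) k
        rw [show t + 1 + (k + 1) = (t + 1 + k) + 1 by omega,
          show t + (k + 1) = t + 1 + k by omega]
        norm_cast
        simp only [Nat.succ_eq_add_one] at this
        omega
      · rw [Set.disjoint_left]
        rintro _ ⟨V, -, rfl⟩ ⟨W, -, h⟩
        exact hab (List.cons.inj h).1.symm

theorem length_le_lcsLen {q : ℕ} {X Y Z : List (Fin q)} (hX : Z.Sublist X) (hY : Z.Sublist Y) :
    Z.length ≤ lcsLen X Y :=
  le_csSup ⟨X.length, by rintro _ ⟨V, hV, -, rfl⟩; exact hV.length_le⟩ ⟨Z, hX, hY, rfl⟩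

theorem lcsLen_le {q : ℕ} {X Y : List (Fin q)} {L : ℕ}
    (h : ∀ Z : List (Fin q), Z.Sublist X → Z.Sublist Y → Z.length ≤ L) : lcsLen X Y ≤ L :=
  csSup_le ⟨0, [], by simp⟩ (by rintro _ ⟨Z, hX, hY, rfl⟩; exact h Z hX hY)

theorem insBall_inter_insBall {q m s t : ℕ} {X Y : List (Fin q)} (hX : X.length + s = m)
    (hY : Y.length + t = m) : insBall q s X ∩ insBall q t Y = commonSupers m X Y := by
  ext W
  simp only [insBall, commonSupers, Set.mem_inter_iff, Set.mem_ofPred_eq, hX, hY]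
  tauto

theorem encard_insBall_inter_le {q n t k : ℕ} (hkt : k ≤ t) (hkn : k ≤ n) {X Y : List (Fin q)}
    (hX : X.length = n + t - k) (hY : Y.length = n) (hd : t - k + 2 * k ≤ editDist X Y) :
    (insBall q k X ∩ insBall q t Y).encard ≤ ((t + k).choose k : ℕ) := by
  rw [insBall_inter_insBall (m := n - k + t + k) (by omega) (by omega)]
  refine encard_commonSupers_le X Y (n - k) t k (by omega) (by omega) fun Z h₁ h₂ => ?_
  have h₃ := length_le_lcsLen h₁ h₂
  have h₄ := h₂.length_le
  unfold editDist at hd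
  omega

theorem Nplus_max_distance (q n t k : ℕ) (hq : 2 ≤ q) (hn : 1 ≤ n)
    (hkt : k ≤ t) (hkn : k ≤ n) :
    Nplus q n t k k = Nat.choose (t + k) k := by
  refine IsGreatest.csSup_eq ⟨?_, ?_⟩
  · let a : Fin q := ⟨1, by omega⟩
    let b : Fin q := ⟨0, by omega⟩
    have hab : a ≠ b := by simp [a, b]
    let P := List.replicate (n - k) b
    let X := P ++ List.replicate t a
    let Y := P ++ List.replicate k b
    have hX : X.length = n + t - k := by simp [X, P]; omega
    have hY : Y.length = n := by simp [Y, P]; omega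
    have hlcs : lcsLen X Y ≤ n - k := lcsLen_le fun Z h₁ h₂ => by
      have hZ : Z = List.replicate Z.length b := by
        refine List.eq_replicate_length.mpr fun z hz => ?_
        have := h₂.subset hz
        simp only [Y, P, List.mem_append, List.mem_replicate] at this
        tauto
      have hc := h₁.count_le b
      rw [hZ] at hc
      simpa [X, P, List.count_replicate, hab] using hc
    have hd : t - k + 2 * k ≤ editDist X Y := by
      unfold editDist
      omega
    refine ⟨X, Y, hX, hY, hd, ?_⟩
    have hsub : (P ++ ·) '' commonSupers (t + k) (List.replicate t a) (List.replicate k b) ⊆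
        insBall q k X ∩ insBall q t Y := by
      rintro _ ⟨W, ⟨hW, h₁, h₂⟩, rfl⟩
      exact ⟨⟨by simp [X, hW]; omega, h₁.append_left P⟩,
        ⟨by simp [Y, hW]; omega, h₂.append_left P⟩⟩
    have hge := Set.encard_le_encard hsub
    rw [(List.append_right_injective P).encard_image] at hge
    have heq := le_antisymm (encard_insBall_inter_le hkt hkn hX hY hd)
      ((choose_le_encard_commonSupers_replicate hab t k).trans hge)
    rw [Set.ncard, heq, ENat.toNat_natCast]
  · rintro _ ⟨X, Y, hX, hY, hd, rfl⟩
    exact ENat.toNat_le_of_le_natCast (encard_insBall_inter_le hkt hkn hX hY hd)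
end

section
/- Let n and t be non-negative integers with n ≥ 2t, let C_n ∈ 𝔽_2^n be the alternating binary string whose i-th symbol (1-indexed) equals i mod 2 (i.e., C_n = 1,0,1,0,…), and let C_{n−2t} be the prefix of C_n of length n−2t. Then D_t(C_n) = I_t(C_{n−2t}); that is, the set of length-(n−t) subsequences of C_n equals the set of length-(n−t) supersequences of C_{n−2t}. -/
open scoped BigOperators

/-- The deletion ball: subsequences of X of length X.length - t. -/
def delBall (q t : ℕ) (X : List (Fin q)) : Set (List (Fin q)) :=
  {Z | Z.length = X.length - t ∧ Z.Sublist X}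

/-- The alternating binary string C_n = 1,0,1,0,...: its i-th symbol (1-indexed) is i mod 2. -/
def altStr (n : ℕ) : List (Fin 2) :=
  (List.range n).map (fun i => ⟨(i + 1) % 2, Nat.mod_lt _ (by norm_num)⟩)

theorem altStr_eq_iterate (n : ℕ) : altStr n = List.iterate (· + 1) 1 n := by
  refine List.ext_getElem (by simp [altStr]) fun i _ _ => ?_
  simp only [altStr, List.getElem_map, List.getElem_range, List.getElem_iterate]
  induction i with
  | zero => rfl
  | succ i ih =>
    rw [Function.iterate_succ_apply', ← ih (by grind) (by grind)]
    ext
    simp [Fin.val_add]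

theorem take_altStr {m n : ℕ} (h : m ≤ n) : (altStr n).take m = altStr m := by
  simp [altStr, ← List.map_take, List.take_range, h]

/-- Deletion-insertion duality for alternating binary strings. -/
theorem sublist_iterate_iff (Z : List (Fin 2)) (a : Fin 2) (n : ℕ) :
    Z.Sublist (List.iterate (· + 1) a n) ↔
      (List.iterate (· + 1) a (2 * Z.length - n)).Sublist Z := by
  induction Z generalizing a n with
  | nil => simp
  | cons b Z ih =>
    have too_long {c : Fin 2} {k : ℕ} {W : List (Fin 2)} (hk : W.length < k) :
        ¬ (List.iterate (· + 1) c k).Sublist W := fun hs => by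
      have := hs.length_le
      simp only [List.length_iterate] at this
      omega
    rcases n with _ | n
    · simpa using too_long (by simp only [List.length_cons]; omega)
    by_cases hab : b = a
    · subst hab
      rw [List.iterate, List.cons_sublist_cons, ih]
      rcases hj : 2 * (b :: Z).length - (n + 1) with _ | j
      · have : 2 * Z.length - n = 0 := by simp only [List.length_cons] at hj; omega
        simp [this]
      · have : 2 * Z.length - n = j := by simp only [List.length_cons] at hj; omega
        rw [List.iterate, List.cons_sublist_cons, this]
    · have hb : a + 1 = b := by omega
      have ha : b + 1 = a := by omega
      have skip (k : ℕ) : (List.iterate (· + 1) a k).Sublist (b :: Z) ↔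
          (List.iterate (· + 1) a k).Sublist Z := by
        rcases k with _ | k
        · simp
        · simp [List.sublist_cons_iff, List.iterate, Ne.symm hab]
      rw [skip, List.iterate, List.sublist_cons_iff, hb]
      rcases n with _ | n
      · simpa [hab] using too_long (by omega)
      · have : 2 * (b :: Z).length - (n + 1 + 1) = 2 * Z.length - n := by
          simp only [List.length_cons]; omega
        rw [this, ← ih, List.iterate, List.cons_sublist_cons, ha]
        simp [hab]

theorem delBall_altStr_eq_insBall_prefix (n t : ℕ) (h : 2 * t ≤ n) :
    delBall 2 t (altStr n) = insBall 2 t ((altStr n).take (n - 2 * t)) := by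
  ext Z
  rw [take_altStr (Nat.sub_le _ _)]
  have hlen (k : ℕ) : (altStr k).length = k := by simp [altStr]
  simp only [delBall, insBall, Set.mem_ofPred_eq, hlen]
  rw [show n - 2 * t + t = n - t by omega]
  refine and_congr_right fun hZ => ?_
  rw [altStr_eq_iterate, altStr_eq_iterate, sublist_iterate_iff,
    show 2 * Z.length - n = n - 2 * t by omega]
end
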